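/- arXiv:1305.4282 — 4 statements merged into one kernel-verified Lean document; each statement's English description precedes it below -/
import Mathlib

section
/- There exists exactly one continuous map F : Q → Q that is affine on each of the nine pieces 𝒜₁,…,𝒜₄, ℬ₁,…,ℬ₄, 𝒞 and satisfies F(Eᵢ) = Eᵢ and F(Pᵢ) = Pᵢ′ for i = 1,…,4. Moreover this map F is a homeomorphism of Q onto itself, it preserves two-dimensional Lebesgue measure (the measure of F⁻¹(S) equals the measure of S for every measurable S ⊆ Q), and it fixes the boundary pointwise: F(x) = x for every x ∈ ∂Q. -/
open Real Set Filter

noncomputable section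

/-- A point in the plane. -/
abbrev Pt : Type := ℝ × ℝ

/-- The unit square `Q = [0,1] × [0,1]`. -/
def unitSq : Set Pt := Icc (0:ℝ) 1 ×ˢ Icc (0:ℝ) 1

/-- The corners `E₁, E₂, E₃, E₄` of the unit square (cyclically indexed). -/
def Ept : Fin 4 → Pt := ![(0,0), (1,0), (1,1), (0,1)]

/-- The inner points `P₁, P₂, P₃, P₄` (cyclically indexed). -/
def Ppt (s t : ℝ) : Fin 4 → Pt := ![(s,t), (1-t,s), (1-s,1-t), (t,1-s)]

/-- The image points `P₁′, P₂′, P₃′, P₄′` (cyclically indexed). -/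
def Ppt' (s t : ℝ) : Fin 4 → Pt := ![(1-s,t), (1-t,1-s), (s,1-t), (t,s)]

/-- The triangle `𝒜ᵢ = conv {Eᵢ, Eᵢ₊₁, Pᵢ}`. -/
def Apiece (s t : ℝ) (i : Fin 4) : Set Pt :=
  convexHull ℝ {Ept i, Ept (i+1), Ppt s t i}

/-- The triangle `ℬᵢ = conv {Eᵢ, Pᵢ, Pᵢ₋₁}`. -/
def Bpiece (s t : ℝ) (i : Fin 4) : Set Pt :=
  convexHull ℝ {Ept i, Ppt s t i, Ppt s t (i-1)}

/-- The central square `𝒞 = conv {P₁, P₂, P₃, P₄}`. -/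
def Cpiece (s t : ℝ) : Set Pt :=
  convexHull ℝ {Ppt s t 0, Ppt s t 1, Ppt s t 2, Ppt s t 3}

/-- `F : Q → Q` is continuous, affine on each of the nine pieces, fixes the
corners `Eᵢ` and maps `Pᵢ` to `Pᵢ′`. -/
def IsPAMap (s t : ℝ) (F : Pt → Pt) : Prop :=
  MapsTo F unitSq unitSq ∧
  ContinuousOn F unitSq ∧
  (∀ i : Fin 4, ∃ g : Pt →ᵃ[ℝ] Pt, EqOn F g (Apiece s t i)) ∧
  (∀ i : Fin 4, ∃ g : Pt →ᵃ[ℝ] Pt, EqOn F g (Bpiece s t i)) ∧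
  (∃ g : Pt →ᵃ[ℝ] Pt, EqOn F g (Cpiece s t)) ∧
  (∀ i : Fin 4, F (Ept i) = Ept i) ∧
  (∀ i : Fin 4, F (Ppt s t i) = Ppt' s t i)

/-- The inequalities and the algebraic relation satisfied by `t = sin² θ`,
`s = sin θ cos θ` for `0 < θ < π / 4`. -/
structure IsAdmissible (s t : ℝ) : Prop where
  pos : 0 < t
  lt : t < s
  lt_half : s < 1 / 2
  sq : s ^ 2 = t - t ^ 2

lemma isAdmissible_sin_cos {θ : ℝ} (hθ : θ ∈ Ioo 0 (π / 4)) :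
    IsAdmissible (sin θ * cos θ) (sin θ ^ 2) := by
  obtain ⟨h0, h1⟩ := hθ
  have hpi := Real.pi_pos
  have hsin : 0 < sin θ := sin_pos_of_pos_of_lt_pi h0 (by linarith)
  have hlt : sin θ < cos θ := by
    rw [← Real.sin_pi_div_two_sub]
    exact Real.sin_lt_sin_of_lt_of_le_pi_div_two (by linarith) (by linarith) (by linarith)
  have hsq := Real.sin_sq_add_cos_sq θ
  refine ⟨by positivity, by nlinarith, by nlinarith, ?_⟩
  linear_combination sin θ ^ 2 * hsq

/-! ### Affine maps of the plane -/

/-- The affine form `(x, y) ↦ p x + q y + r`. -/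
def affineForm (p q r : ℝ) : Pt →ᵃ[ℝ] ℝ :=
  (p • LinearMap.fst ℝ ℝ ℝ + q • LinearMap.snd ℝ ℝ ℝ).toAffineMap + AffineMap.const ℝ Pt r

@[simp] lemma affineForm_apply (p q r : ℝ) (x : Pt) :
    affineForm p q r x = p * x.1 + q * x.2 + r := by
  simp [affineForm]

/-- The reflection of the unit square in its vertical axis. -/
def reflection : Pt →ᵃ[ℝ] Pt := (affineForm (-1) 0 1).prod (affineForm 0 1 0)

@[simp] lemma reflection_apply (x : Pt) : reflection x = (1 - x.1, x.2) := by
  ext <;> simp [reflection]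
  ring

lemma reflection_reflection (x : Pt) : reflection (reflection x) = x := by simp

/-- The quarterTurn of the unit square by a quarter turn clockwise. -/
def quarterTurn : Pt →ᵃ[ℝ] Pt := (affineForm 0 1 0).prod (affineForm (-1) 0 1)

@[simp] lemma quarterTurn_apply (x : Pt) : quarterTurn x = (x.2, 1 - x.1) := by
  ext <;> simp [quarterTurn]
  ring

lemma affineMap_eqOn_convexHull {f g : Pt →ᵃ[ℝ] Pt} {V : Set Pt} (h : EqOn f g V) :
    EqOn f g (convexHull ℝ V) := by
  have hV : V ⊆ (f - g) ⁻¹' {0} := fun x hx => by simp [h hx]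
  intro x hx
  have := convexHull_min hV ((convex_singleton 0).affine_preimage (f - g)) hx
  simpa [sub_eq_zero] using this

lemma affineMap_le_on_convexHull {f g : Pt →ᵃ[ℝ] ℝ} {V : Set Pt} (h : ∀ x ∈ V, f x ≤ g x) :
    ∀ x ∈ convexHull ℝ V, f x ≤ g x := by
  have hV : V ⊆ (f - g) ⁻¹' Iic 0 := fun x hx => by simpa using h x hx
  intro x hx
  have := convexHull_min hV ((convex_Iic 0).affine_preimage (f - g)) hx
  simpa using this

/-- The signed area of the parallelogram spanned by two vectors. -/
def cross (a b : Pt) : ℝ := a.1 * b.2 - a.2 * b.1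

lemma cross_map (L : Pt →ₗ[ℝ] Pt) (a b : Pt) :
    cross (L a) (L b) = LinearMap.det L * cross a b := by
  have h (v : Pt) : L v = v.1 • L (1, 0) + v.2 • L (0, 1) := by
    rw [← map_smul, ← map_smul, ← map_add]
    simp
  have hdet : LinearMap.det L = cross (L (1, 0)) (L (0, 1)) := by
    rw [← LinearMap.det_toMatrix (Module.Basis.finTwoProd ℝ), Matrix.det_fin_two]
    simp [LinearMap.toMatrix_apply, cross]
    ring
  rw [hdet, h a, h b]
  simp [cross]
  ring

lemma volume_image_affineMap {g : Pt →ᵃ[ℝ] Pt} {a b c : Pt}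
    (h0 : cross (b - a) (c - a) ≠ 0)
    (h : cross (g b - g a) (g c - g a) = cross (b - a) (c - a) ∨
      cross (g b - g a) (g c - g a) = -cross (b - a) (c - a)) (S : Set Pt) :
    MeasureTheory.volume (g '' S) = MeasureTheory.volume S := by
  have hdet : |LinearMap.det g.linear| = 1 := by
    have hc := cross_map g.linear (b - a) (c - a)
    rw [← vsub_eq_sub b a, ← vsub_eq_sub c a, g.linearMap_vsub, g.linearMap_vsub] at hc
    simp only [vsub_eq_sub] at hc
    rw [hc] at h
    rcases h with h | h
    · rw [mul_eq_right₀ h0] at h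
      simp [h]
    · rw [neg_eq_neg_one_mul] at h
      simp [mul_right_cancel₀ h0 h]
  have himage : g '' S = (fun x => x + g 0) '' (g.linear '' S) := by
    rw [image_image]
    refine image_congr fun x _ => ?_
    simpa using congrFun g.decomp x
  rw [himage, image_add_right, MeasureTheory.measure_preimage_add_right,
    MeasureTheory.Measure.addHaar_image_linearMap, hdet]
  simp

lemma volume_image_le_of_cover {ι : Type*} {T : Pt → Pt} {K : ι → Set Pt} (I : Finset ι)
    (hK : ∀ i, MeasurableSet (K i))
    (hT : ∀ i, ∀ S ⊆ K i, MeasureTheory.volume (T '' S) ≤ MeasureTheory.volume S) :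
    ∀ S : Set Pt, (∀ x ∈ S, ∃ i ∈ I, x ∈ K i) →
      MeasureTheory.volume (T '' S) ≤ MeasureTheory.volume S := by
  classical
  induction I using Finset.induction_on with
  | empty =>
    intro S hS
    have : S = ∅ := eq_empty_of_forall_notMem fun x hx => by simpa using hS x hx
    simp [this]
  | insert i I _ ih =>
    intro S hS
    calc MeasureTheory.volume (T '' S)
        = MeasureTheory.volume (T '' (S ∩ K i) ∪ T '' (S \ K i)) := by
          rw [← image_union, inter_union_sdiff]
      _ ≤ MeasureTheory.volume (T '' (S ∩ K i)) + MeasureTheory.volume (T '' (S \ K i)) :=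
          MeasureTheory.measure_union_le _ _
      _ ≤ MeasureTheory.volume (S ∩ K i) + MeasureTheory.volume (S \ K i) := by
          refine add_le_add (hT i _ inter_subset_right) (ih _ fun x hx => ?_)
          obtain ⟨j, hj, hxj⟩ := hS x hx.1
          rcases Finset.mem_insert.1 hj with rfl | hj
          · exact absurd hxj hx.2
          · exact ⟨j, hj, hxj⟩
      _ = MeasureTheory.volume S := MeasureTheory.measure_inter_add_sdiff S (hK i)

lemma mem_convexHull_triangle {a b c x : Pt} (h0 : 0 < cross (b - a) (c - a))
    (ha : 0 ≤ cross (c - b) (x - b)) (hb : 0 ≤ cross (a - c) (x - c))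
    (hc : 0 ≤ cross (b - a) (x - a)) : x ∈ convexHull ℝ {a, b, c} := by
  have hD := h0.ne'
  let w : Fin 3 → ℝ := ![cross (c - b) (x - b) / cross (b - a) (c - a),
    cross (a - c) (x - c) / cross (b - a) (c - a), cross (b - a) (x - a) / cross (b - a) (c - a)]
  have hx : ∑ i, w i • (![a, b, c] : Fin 3 → Pt) i = x := by
    ext <;> simp [w, Fin.sum_univ_three] <;> field_simp <;> simp [cross] <;> ring
  rw [← hx]
  refine (convex_convexHull ℝ _).sum_mem (fun i _ => ?_) ?_ fun i _ => subset_convexHull ℝ _ ?_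
  · fin_cases i
    exacts [div_nonneg ha h0.le, div_nonneg hb h0.le, div_nonneg hc h0.le]
  · simp only [w, Fin.sum_univ_three, Matrix.cons_val]
    field_simp
    simp [cross]
    ring
  · fin_cases i <;> simp

/-! ### The nine cells -/

/-- The index set of the nine cells: `𝒜ᵢ`, `ℬᵢ` and `𝒞`. -/
abbrev Cell : Type := Fin 4 ⊕ Fin 4 ⊕ Unit

/-- The vertices of a cell. -/
def cellVertices (s t : ℝ) : Cell → Set Pt
  | .inl i => {Ept i, Ept (i + 1), Ppt s t i}
  | .inr (.inl i) => {Ept i, Ppt s t i, Ppt s t (i - 1)}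
  | .inr (.inr _) => {Ppt s t 0, Ppt s t 1, Ppt s t 2, Ppt s t 3}

lemma finite_cellVertices (s t : ℝ) (k : Cell) : (cellVertices s t k).Finite := by
  rcases k with i | i | _ <;> simp [cellVertices]

/-- The side form of the line through `Eᵢ`, `Pᵢ` and `Pᵢ₊₁`: it is nonnegative on the side
containing `𝒞`. -/
def sideForm (s t : ℝ) (x : Pt) : Fin 4 → ℝ :=
  ![s * x.2 - t * x.1, s * (1 - x.1) - t * x.2, s * (1 - x.2) - t * (1 - x.1),
    s * x.1 - t * (1 - x.2)]

/-- The side form of the line through `Eᵢ₊₁` and `Pᵢ`, which separates `𝒜ᵢ` from `ℬᵢ₊₁`. -/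
def splitForm (s t : ℝ) (x : Pt) : Fin 4 → ℝ :=
  ![t * (1 - x.1) - (1 - s) * x.2, t * (1 - x.2) - (1 - s) * (1 - x.1),
    t * x.1 - (1 - s) * (1 - x.2), t * x.2 - (1 - s) * x.1]

/-- The triangle `Eᵢ Eᵢ₊₁ Pᵢ₊₁`, cut out by two side forms, is covered by `𝒜ᵢ` and `ℬᵢ₊₁`. -/
lemma exists_mem_cell_of_sideForm {s t : ℝ} (h : IsAdmissible s t) {x : Pt} (hx : x ∈ unitSq)
    (i : Fin 4) (h0 : sideForm s t x i ≤ 0) (h1 : 0 ≤ sideForm s t x (i + 1)) :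
    ∃ k, x ∈ convexHull ℝ (cellVertices s t k) := by
  obtain ⟨ht, hts, hs, hsq⟩ := h
  obtain ⟨⟨hx0, hx1⟩, hy0, hy1⟩ := hx
  rcases le_total (splitForm s t x i) 0 with hi | hi
  · refine ⟨.inr (.inl (i + 1)), ?_⟩
    fin_cases i <;> simp [sideForm, splitForm] at h0 h1 hi <;>
      refine mem_convexHull_triangle ?_ ?_ ?_ ?_ <;> simp [cross, Ept, Ppt] <;> nlinarith
  · refine ⟨.inl i, ?_⟩
    fin_cases i <;> simp [sideForm, splitForm] at h0 h1 hi <;>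
      refine mem_convexHull_triangle ?_ ?_ ?_ ?_ <;> simp [cross, Ept, Ppt] <;> nlinarith

lemma mem_Cpiece_of_sideForm {s t : ℝ} (h : IsAdmissible s t) {x : Pt}
    (hx : ∀ i, 0 ≤ sideForm s t x i) : x ∈ Cpiece s t := by
  obtain ⟨ht, hts, hs, hsq⟩ := h
  have h0 := hx 0
  have h1 := hx 1
  have h2 := hx 2
  have h3 := hx 3
  simp [sideForm] at h0 h1 h2 h3
  rcases le_total (cross (Ppt s t 2 - Ppt s t 0) (x - Ppt s t 0)) 0 with hd | hd
  · refine convexHull_mono (s := {Ppt s t 0, Ppt s t 1, Ppt s t 2}) (by grind) ?_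
    simp [cross, Ppt] at hd
    refine mem_convexHull_triangle ?_ ?_ ?_ ?_ <;> simp [cross, Ppt] <;> nlinarith
  · refine convexHull_mono (s := {Ppt s t 0, Ppt s t 2, Ppt s t 3}) (by grind) ?_
    simp [cross, Ppt] at hd
    refine mem_convexHull_triangle ?_ ?_ ?_ ?_ <;> simp [cross, Ppt] <;> nlinarith

lemma exists_mem_cell {s t : ℝ} (h : IsAdmissible s t) {x : Pt} (hx : x ∈ unitSq) :
    ∃ k, x ∈ convexHull ℝ (cellVertices s t k) := by
  by_contra hno
  have hstep (i : Fin 4) (hi : sideForm s t x i < 0) : sideForm s t x (i + 1) < 0 :=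
    lt_of_not_ge fun hi' => hno (exists_mem_cell_of_sideForm h hx i hi.le hi')
  have hneg : ∃ i, sideForm s t x i < 0 := by
    by_contra! hpos
    exact hno ⟨.inr (.inr ()), mem_Cpiece_of_sideForm h hpos⟩
  obtain ⟨i, hi⟩ := hneg
  have hsum : ∑ j, sideForm s t x j = 2 * (s - t) := by
    simp [Fin.sum_univ_four, sideForm]
    ring
  have hall : ∀ j, sideForm s t x j < 0 := by
    have hi1 := hstep _ hi
    have hi2 := hstep _ hi1
    have hi3 := hstep _ hi2
    intro j
    fin_cases i <;> fin_cases j <;> assumption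
  have := Finset.sum_nonpos fun j (_ : j ∈ Finset.univ) => (hall j).le
  have := h.lt
  linarith

/-- The cell onto which the clockwise quarter turn carries a given cell. -/
def turnedCell : Cell → Cell
  | .inl i => .inl (i - 1)
  | .inr (.inl i) => .inr (.inl (i - 1))
  | .inr (.inr _) => .inr (.inr ())

lemma quarterTurn_Ept (i : Fin 4) : quarterTurn (Ept i) = Ept (i - 1) := by
  fin_cases i <;> simp [Ept]

lemma quarterTurn_Ppt (s t : ℝ) (i : Fin 4) : quarterTurn (Ppt s t i) = Ppt s t (i - 1) := by
  fin_cases i <;> simp [Ppt]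

lemma image_quarterTurn_cellVertices (s t : ℝ) (k : Cell) :
    quarterTurn '' cellVertices s t k = cellVertices s t (turnedCell k) := by
  rcases k with i | i | _
  · simp only [cellVertices, turnedCell, image_insert_eq, image_singleton, quarterTurn_Ept,
      quarterTurn_Ppt, add_sub_right_comm]
  · simp only [cellVertices, turnedCell, image_insert_eq, image_singleton, quarterTurn_Ept,
      quarterTurn_Ppt]
  · simp only [cellVertices, turnedCell, image_insert_eq, image_singleton, quarterTurn_Ppt]
    ext
    simp
    tauto

/-- The function `u` agrees with an affine map on the cell `k`. -/
def IsAffineOnCell {E : Type*} [AddCommGroup E] [Module ℝ E] (s t : ℝ) (u : Pt → E) (k : Cell) :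
    Prop :=
  ∃ g : Pt →ᵃ[ℝ] E, EqOn u g (convexHull ℝ (cellVertices s t k))

lemma IsAffineOnCell.comp_quarterTurn {E : Type*} [AddCommGroup E] [Module ℝ E] {s t : ℝ}
    {u : Pt → E} {k : Cell} (h : IsAffineOnCell s t u (turnedCell k)) :
    IsAffineOnCell s t (u ∘ quarterTurn) k := by
  obtain ⟨g, hg⟩ := h
  refine ⟨g.comp quarterTurn, fun x hx => hg ?_⟩
  rw [← image_quarterTurn_cellVertices, ← AffineMap.image_convexHull]
  exact mem_image_of_mem _ hx

/-! ### Existence of the map -/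

/-- The affine forms equal to `1` at `P₁` and vanishing on the sides `E₁E₂`, `P₄E₁`, `E₂P₂`
and `P₂P₄` of the quadrilateral `E₁E₂P₂P₄`, respectively. -/
def tentForm (s t : ℝ) : Fin 4 → (Pt →ᵃ[ℝ] ℝ) :=
  ![affineForm 0 (1 / t) 0,
    affineForm ((1 - s) / (s - t)) (-t / (s - t)) 0,
    affineForm (-s / (s - t)) (-t / (s - t)) (s / (s - t)),
    affineForm (-1) (-(1 - 2 * t) / (1 - 2 * s)) (1 / 2 + (1 - 2 * t) / (2 * (1 - 2 * s)))]

/-- The tent over the quadrilateral `E₁E₂P₂P₄` with apex `P₁`. -/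
def tent (s t : ℝ) (x : Pt) : ℝ :=
  max 0 (min (min (tentForm s t 0 x) (tentForm s t 1 x))
    (min (tentForm s t 2 x) (tentForm s t 3 x)))

lemma continuous_tent (s t : ℝ) : Continuous (tent s t) := by
  have h (i : Fin 4) : Continuous (tentForm s t i) :=
    (tentForm s t i).continuous_of_finiteDimensional
  unfold tent
  fun_prop

lemma tent_eq_of_le {s t : ℝ} {V : Set Pt} (i : Fin 4)
    (h : ∀ j, ∀ x ∈ V, tentForm s t i x ≤ tentForm s t j x) {x : Pt} (hx : x ∈ convexHull ℝ V) :
    tent s t x = max 0 (tentForm s t i x) := by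
  have hle j := affineMap_le_on_convexHull (h j) x hx
  have h0 := hle 0
  have h1 := hle 1
  have h2 := hle 2
  have h3 := hle 3
  unfold tent
  congr 1
  refine le_antisymm ?_ (by simp [*])
  fin_cases i <;> simp

lemma tent_eq_zero {s t : ℝ} {V : Set Pt} (i : Fin 4)
    (h : ∀ x ∈ V, tentForm s t i x ≤ 0) {x : Pt} (hx : x ∈ convexHull ℝ V) : tent s t x = 0 := by
  have hle := affineMap_le_on_convexHull (g := 0) (by simpa using h) x hx
  unfold tent
  refine max_eq_left (le_trans ?_ hle)
  fin_cases i <;> simp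

/-- The values of the tent forms at the corners. -/
lemma tentForm_Ept {s t : ℝ} (h : IsAdmissible s t) (i j : Fin 4) :
    tentForm s t i (Ept j) =
      ![![0, 0, 1 / t, 1 / t],
        ![0, (1 - s) / (s - t), (1 - s - t) / (s - t), -t / (s - t)],
        ![s / (s - t), 0, -t / (s - t), 1],
        ![(1 - s - t) / (1 - 2 * s), (s - t) / (1 - 2 * s), -(1 - s - t) / (1 - 2 * s),
          -(s - t) / (1 - 2 * s)]] i j := by
  obtain ⟨ht, hts, hs, hsq⟩ := h
  have h1 : s - t ≠ 0 := by linarith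
  have h2 : 1 - 2 * s ≠ 0 := by linarith
  fin_cases i <;> fin_cases j <;> simp [tentForm, Ept] <;> field_simp <;> ring

/-- The values of the tent forms at the inner points. -/
lemma tentForm_Ppt {s t : ℝ} (h : IsAdmissible s t) (i j : Fin 4) :
    tentForm s t i (Ppt s t j) =
      ![![1, s / t, (1 - t) / t, (1 - s) / t],
        ![1, (1 - s - t) / (s - t), (1 - 2 * s) / (s - t), 0],
        ![1, 0, 0, 1],
        ![1, 0, -1, 0]] i j := by
  obtain ⟨ht, hts, hs, hsq⟩ := h
  have h1 : s - t ≠ 0 := by linarith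
  have h2 : 1 - 2 * s ≠ 0 := by linarith
  have h3 : 1 - s * 2 ≠ 0 := by linarith
  fin_cases i <;> fin_cases j <;> simp [tentForm, Ppt] <;> field_simp <;> linarith

lemma tent_eqOn_Apiece {s t : ℝ} (h : IsAdmissible s t) (i : Fin 4) :
    EqOn (tent s t) ((![tentForm s t 0, 0, 0, 0] : Fin 4 → (Pt →ᵃ[ℝ] ℝ)) i) (Apiece s t i) := by
  obtain ⟨ht, hts, hs, -⟩ := id h
  have h0 : 0 < s := by linarith
  have h1 : 0 < s - t := by linarith
  have h2 : 0 < 1 - 2 * s := by linarith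
  have h3 : 0 < 1 - s - t := by linarith
  have h4 : 0 < 1 - s := by linarith
  intro x hx
  fin_cases i
  · have hpos := affineMap_le_on_convexHull (f := 0) (g := tentForm s t 0)
      (by simp [tentForm_Ept h, tentForm_Ppt h]) x hx
    refine (tent_eq_of_le 0 (fun j => ?_) hx).trans (max_eq_right hpos)
    fin_cases j <;> simp [tentForm_Ept h, tentForm_Ppt h]
    all_goals try constructor
    all_goals positivity
  · refine tent_eq_zero 2 ?_ hx
    simp [tentForm_Ept h, tentForm_Ppt h]
    rw [neg_div, neg_nonpos]
    positivity
  · refine tent_eq_zero 3 ?_ hx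
    simp [tentForm_Ept h, tentForm_Ppt h]
    constructor <;> exact div_nonpos_of_nonpos_of_nonneg (by linarith) h2.le
  · refine tent_eq_zero 1 ?_ hx
    simp [tentForm_Ept h, tentForm_Ppt h]
    rw [neg_div, neg_nonpos]
    positivity

lemma tent_eqOn_Bpiece {s t : ℝ} (h : IsAdmissible s t) (i : Fin 4) :
    EqOn (tent s t) ((![tentForm s t 1, tentForm s t 2, 0, 0] : Fin 4 → (Pt →ᵃ[ℝ] ℝ)) i)
      (Bpiece s t i) := by
  obtain ⟨ht, hts, hs, -⟩ := id h
  have h0 : 0 < s := by linarith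
  have h1 : 0 < s - t := by linarith
  have h2 : 0 < 1 - 2 * s := by linarith
  have h3 : 0 < 1 - s - t := by linarith
  have h4 : 0 < 1 - s := by linarith
  intro x hx
  fin_cases i
  · have hpos := affineMap_le_on_convexHull (f := 0) (g := tentForm s t 1)
      (by simp [tentForm_Ept h, tentForm_Ppt h]) x hx
    refine (tent_eq_of_le 1 (fun j => ?_) hx).trans (max_eq_right hpos)
    fin_cases j <;> simp [tentForm_Ept h, tentForm_Ppt h]
    all_goals positivity
  · have hpos := affineMap_le_on_convexHull (f := 0) (g := tentForm s t 2)
      (by simp [tentForm_Ept h, tentForm_Ppt h]) x hx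
    refine (tent_eq_of_le 2 (fun j => ?_) hx).trans (max_eq_right hpos)
    fin_cases j <;> simp [tentForm_Ept h, tentForm_Ppt h]
    all_goals try constructor
    all_goals positivity
  · refine tent_eq_zero 3 ?_ hx
    simp [tentForm_Ept h, tentForm_Ppt h]
    exact div_nonpos_of_nonpos_of_nonneg (by linarith) h2.le
  · refine tent_eq_zero 3 ?_ hx
    simp [tentForm_Ept h, tentForm_Ppt h]
    exact div_nonpos_of_nonpos_of_nonneg (by linarith) h2.le

lemma tent_eqOn_Cpiece {s t : ℝ} (h : IsAdmissible s t) :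
    EqOn (tent s t) (fun x => max 0 (tentForm s t 3 x)) (Cpiece s t) := by
  obtain ⟨ht, hts, hs, -⟩ := id h
  have h0 : 0 < s := by linarith
  have h1 : 0 < s - t := by linarith
  have h2 : 0 < 1 - 2 * s := by linarith
  have h3 : 0 < 1 - s - t := by linarith
  have h4 : 0 < 1 - s := by linarith
  intro x hx
  refine tent_eq_of_le 3 (fun j => ?_) hx
  fin_cases j <;> simp [tentForm_Ppt h]
  · have h5 : 0 < 1 - t := by linarith
    refine ⟨by positivity, le_trans (by simp) (div_pos h5 ht).le, by positivity⟩
  · exact ⟨by positivity, le_trans (by simp) (div_pos h2 h1).le⟩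

lemma tent_Ept {s t : ℝ} (h : IsAdmissible s t) (i : Fin 4) : tent s t (Ept i) = 0 := by
  rw [tent_eqOn_Apiece h i (subset_convexHull ℝ _ (by simp))]
  fin_cases i <;> simp [tentForm_Ept h]

lemma tent_Ppt {s t : ℝ} (h : IsAdmissible s t) (i : Fin 4) :
    tent s t (Ppt s t i) = ![1, 0, 0, 0] i := by
  rw [tent_eqOn_Apiece h i (subset_convexHull ℝ _ (by simp))]
  fin_cases i <;> simp [tentForm_Ppt h]

/-- The piecewise affine function equal to `1` at `P₁`, to `-1` at `P₃` and to `0` at all other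
vertices. -/
def doubleTent (s t : ℝ) (x : Pt) : ℝ :=
  tent s t x - tent s t (quarterTurn (quarterTurn x))

lemma doubleTent_Ept {s t : ℝ} (h : IsAdmissible s t) (i : Fin 4) :
    doubleTent s t (Ept i) = 0 := by
  simp only [doubleTent, quarterTurn_Ept, tent_Ept h, sub_zero]

lemma doubleTent_Ppt {s t : ℝ} (h : IsAdmissible s t) (i : Fin 4) :
    doubleTent s t (Ppt s t i) = ![1, 0, -1, 0] i := by
  simp only [doubleTent, quarterTurn_Ppt, tent_Ppt h, sub_sub]
  fin_cases i <;> simp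

lemma isAffineOnCell_doubleTent {s t : ℝ} (h : IsAdmissible s t) (k : Cell) :
    IsAffineOnCell s t (doubleTent s t) k := by
  have hsub (k : Cell) (h₁ : IsAffineOnCell s t (tent s t) k)
      (h₂ : IsAffineOnCell s t (tent s t) (turnedCell (turnedCell k))) :
      IsAffineOnCell s t (doubleTent s t) k := by
    obtain ⟨g, hg⟩ := h₁
    obtain ⟨g', hg'⟩ := h₂.comp_quarterTurn.comp_quarterTurn
    exact ⟨g - g', fun x hx => congrArg₂ (· - ·) (hg hx) (hg' hx)⟩
  rcases k with i | i | _
  · exact hsub _ ⟨_, tent_eqOn_Apiece h i⟩ ⟨_, tent_eqOn_Apiece h _⟩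
  · exact hsub _ ⟨_, tent_eqOn_Bpiece h i⟩ ⟨_, tent_eqOn_Bpiece h _⟩
  · refine ⟨tentForm s t 3, fun x hx => ?_⟩
    have hx' : quarterTurn (quarterTurn x) ∈ Cpiece s t := by
      have hturn (y : Pt) (hy : y ∈ Cpiece s t) : quarterTurn y ∈ Cpiece s t := by
        rw [Cpiece, ← cellVertices.eq_3 s t (), ← turnedCell.eq_3 (),
          ← image_quarterTurn_cellVertices, ← AffineMap.image_convexHull]
        exact mem_image_of_mem _ hy
      exact hturn _ (hturn _ hx)
    have hneg : tentForm s t 3 (quarterTurn (quarterTurn x)) = -tentForm s t 3 x := by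
      have := h.lt_half
      have h2 : 1 - s * 2 ≠ 0 := by linarith
      simp [tentForm]
      field_simp
      ring
    rw [doubleTent, tent_eqOn_Cpiece h hx, tent_eqOn_Cpiece h hx']
    simp only [hneg]
    grind

/-- The piecewise affine map of the square fixing every `Eᵢ` and moving every `Pᵢ` to `Pᵢ′`. -/
def squareMap (s t : ℝ) (x : Pt) : Pt :=
  x + (1 - 2 * s) • (doubleTent s t x, doubleTent s t (quarterTurn x))

lemma continuous_squareMap (s t : ℝ) : Continuous (squareMap s t) := by
  have h := continuous_tent s t
  have hq : Continuous quarterTurn := quarterTurn.continuous_of_finiteDimensional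
  unfold squareMap doubleTent
  fun_prop

lemma squareMap_Ept {s t : ℝ} (h : IsAdmissible s t) (i : Fin 4) :
    squareMap s t (Ept i) = Ept i := by
  simp [squareMap, quarterTurn_Ept, doubleTent_Ept h, -quarterTurn_apply]

lemma squareMap_Ppt {s t : ℝ} (h : IsAdmissible s t) (i : Fin 4) :
    squareMap s t (Ppt s t i) = Ppt' s t i := by
  simp only [squareMap, quarterTurn_Ppt, doubleTent_Ppt h]
  fin_cases i <;> ext <;> simp [Ppt, Ppt'] <;> ring

lemma isAffineOnCell_squareMap {s t : ℝ} (h : IsAdmissible s t) (k : Cell) :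
    IsAffineOnCell s t (squareMap s t) k := by
  obtain ⟨g, hg⟩ := isAffineOnCell_doubleTent h k
  obtain ⟨g', hg'⟩ := (isAffineOnCell_doubleTent h (turnedCell k)).comp_quarterTurn
  refine ⟨AffineMap.id ℝ Pt + (1 - 2 * s) • g.prod g', fun x hx => ?_⟩
  rw [squareMap, hg hx, show doubleTent s t (quarterTurn x) = g' x from hg' hx]
  rfl

/-! ### Properties shared by all maps that are affine on the nine cells -/

lemma IsPAMap.isAffineOnCell {s t : ℝ} {F : Pt → Pt} (hF : IsPAMap s t F) (k : Cell) :
    IsAffineOnCell s t F k := by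
  obtain ⟨-, -, hA, hB, hC, -, -⟩ := hF
  rcases k with i | i | _
  exacts [hA i, hB i, hC]

lemma cellVertices_subset (s t : ℝ) (k : Cell) :
    cellVertices s t k ⊆ range Ept ∪ range (Ppt s t) := by
  rcases k with i | i | _ <;> simp [cellVertices, insert_subset_iff]

lemma IsPAMap.eqOn {s t : ℝ} (h : IsAdmissible s t) {F G : Pt → Pt} (hF : IsPAMap s t F)
    (hG : IsPAMap s t G) : EqOn F G unitSq := by
  intro x hx
  obtain ⟨k, hk⟩ := exists_mem_cell h hx
  obtain ⟨f, hf⟩ := hF.isAffineOnCell k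
  obtain ⟨g, hg⟩ := hG.isAffineOnCell k
  obtain ⟨-, -, -, -, -, hFE, hFP⟩ := hF
  obtain ⟨-, -, -, -, -, hGE, hGP⟩ := hG
  rw [hf hk, hg hk]
  refine affineMap_eqOn_convexHull (fun v hv => ?_) hk
  rw [← hf (subset_convexHull ℝ _ hv), ← hg (subset_convexHull ℝ _ hv)]
  rcases cellVertices_subset s t k hv with ⟨i, rfl⟩ | ⟨i, rfl⟩
  · rw [hFE, hGE]
  · rw [hFP, hGP]

lemma convex_unitSq : Convex ℝ unitSq := (convex_Icc 0 1).prod (convex_Icc 0 1)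

lemma isPAMap_squareMap {s t : ℝ} (h : IsAdmissible s t) : IsPAMap s t (squareMap s t) := by
  refine ⟨fun x hx => ?_, (continuous_squareMap s t).continuousOn,
    fun i => isAffineOnCell_squareMap h (.inl i),
    fun i => isAffineOnCell_squareMap h (.inr (.inl i)),
    isAffineOnCell_squareMap h (.inr (.inr ())), squareMap_Ept h, squareMap_Ppt h⟩
  obtain ⟨k, hk⟩ := exists_mem_cell h hx
  obtain ⟨g, hg⟩ := isAffineOnCell_squareMap h k
  rw [hg hk]
  refine convexHull_min (s := cellVertices s t k) (fun v hv => ?_)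
    (convex_unitSq.affine_preimage g) hk
  rw [mem_preimage, ← hg (subset_convexHull ℝ _ hv)]
  obtain ⟨ht, hts, hs, -⟩ := id h
  rcases cellVertices_subset s t k hv with ⟨i, rfl⟩ | ⟨i, rfl⟩
  · rw [squareMap_Ept h]
    fin_cases i <;> simp [Ept, unitSq]
  · rw [squareMap_Ppt h]
    fin_cases i <;> simp [Ppt', unitSq] <;> grind

lemma reflection_mem_unitSq {x : Pt} (hx : x ∈ unitSq) : reflection x ∈ unitSq := by
  simp only [unitSq, mem_prod, mem_Icc, reflection_apply] at hx ⊢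
  grind

/-- The cell onto which the reflection carries the image of a given cell under a map as in
`IsPAMap`. -/
def reflectedCell : Cell → Cell
  | .inl i => .inl (-i)
  | .inr (.inl i) => .inr (.inl (1 - i))
  | .inr (.inr _) => .inr (.inr ())

lemma reflection_Ept (i : Fin 4) : reflection (Ept i) = Ept (1 - i) := by
  fin_cases i <;> simp [Ept]

lemma reflection_Ppt' (s t : ℝ) (i : Fin 4) : reflection (Ppt' s t i) = Ppt s t (-i) := by
  fin_cases i <;> simp [Ppt, Ppt']

section

variable {s t : ℝ} {F : Pt → Pt}

lemma IsPAMap.reflection_Ept (hF : IsPAMap s t F) (i : Fin 4) :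
    reflection (F (Ept i)) = Ept (1 - i) := by
  rw [hF.2.2.2.2.2.1, _root_.reflection_Ept]

lemma IsPAMap.reflection_Ppt (hF : IsPAMap s t F) (i : Fin 4) :
    reflection (F (Ppt s t i)) = Ppt s t (-i) := by
  rw [hF.2.2.2.2.2.2, reflection_Ppt']

lemma IsPAMap.image_cellVertices (hF : IsPAMap s t F) (k : Cell) :
    (fun x => reflection (F x)) '' cellVertices s t k = cellVertices s t (reflectedCell k) := by
  rcases k with i | i | _
  · simp only [cellVertices, reflectedCell, image_insert_eq, image_singleton, hF.reflection_Ept,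
      hF.reflection_Ppt]
    rw [insert_comm, show 1 - (i + 1) = -i by abel, show 1 - i = -i + 1 by abel]
  · simp only [cellVertices, reflectedCell, image_insert_eq, image_singleton, hF.reflection_Ept,
      hF.reflection_Ppt]
    rw [pair_comm, show -(i - 1) = 1 - i by abel, show 1 - i - 1 = -i by abel]
  · simp only [cellVertices, reflectedCell, image_insert_eq, image_singleton, hF.reflection_Ppt]
    ext
    simp
    tauto

lemma IsPAMap.involutive (h : IsAdmissible s t) (hF : IsPAMap s t F) {x : Pt} (hx : x ∈ unitSq) :
    reflection (F (reflection (F x))) = x := by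
  obtain ⟨k, hk⟩ := exists_mem_cell h hx
  obtain ⟨f, hf⟩ := hF.isAffineOnCell k
  obtain ⟨g, hg⟩ := hF.isAffineOnCell (reflectedCell k)
  have hmaps (y : Pt) (hy : y ∈ convexHull ℝ (cellVertices s t k)) :
      reflection (F y) ∈ convexHull ℝ (cellVertices s t (reflectedCell k)) := by
    have himage : (reflection.comp f) '' cellVertices s t k =
        cellVertices s t (reflectedCell k) := by
      rw [← hF.image_cellVertices k]
      exact image_congr fun v hv => by simp [hf (subset_convexHull ℝ _ hv)]
    rw [← himage, ← AffineMap.image_convexHull]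
    exact ⟨y, hy, by simp [hf hy]⟩
  have hcomp (y : Pt) (hy : y ∈ convexHull ℝ (cellVertices s t k)) :
      reflection (F (reflection (F y))) = (reflection.comp (g.comp (reflection.comp f))) y := by
    rw [hg (hmaps y hy), hf hy]
    rfl
  rw [hcomp x hk]
  refine affineMap_eqOn_convexHull (g := AffineMap.id ℝ Pt) (fun v hv => ?_) hk
  rw [← hcomp v (subset_convexHull ℝ _ hv)]
  rcases cellVertices_subset s t k hv with ⟨i, rfl⟩ | ⟨i, rfl⟩
  · simp [hF.reflection_Ept, -reflection_apply]
  · simp [hF.reflection_Ppt, -reflection_apply]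

/-- The inverse is conjugate to the map itself by the reflection. -/
lemma IsPAMap.apply_conj (h : IsAdmissible s t) (hF : IsPAMap s t F) {x : Pt}
    (hx : x ∈ unitSq) : F (reflection (F (reflection x))) = x := by
  have := congrArg reflection (hF.involutive h (reflection_mem_unitSq hx))
  rwa [reflection_reflection, reflection_reflection] at this

lemma IsPAMap.exists_homeomorph (h : IsAdmissible s t) (hF : IsPAMap s t F) :
    ∃ e : unitSq ≃ₜ unitSq, ∀ x : unitSq, (e x : Pt) = F x := by
  have hr : Continuous reflection := reflection.continuous_of_finiteDimensional
  have hr' : MapsTo reflection unitSq unitSq := fun _ => reflection_mem_unitSq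
  have hm := hF.1
  have hc := hF.2.1
  have hinv : ContinuousOn (reflection ∘ F ∘ reflection) unitSq :=
    hr.comp_continuousOn (hc.comp hr.continuousOn hr')
  refine ⟨{ toFun := hm.restrict
            invFun := (hr'.comp (hm.comp hr')).restrict
            left_inv := fun x => Subtype.ext (hF.involutive h x.2)
            right_inv := fun x => Subtype.ext (hF.apply_conj h x.2)
            continuous_toFun := hc.mapsToRestrict hm
            continuous_invFun := hinv.mapsToRestrict _ }, fun x => rfl⟩

lemma IsPAMap.volume_image_cell (h : IsAdmissible s t) (hF : IsPAMap s t F) (k : Cell) {S : Set Pt}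
    (hS : S ⊆ convexHull ℝ (cellVertices s t k)) :
    MeasureTheory.volume (F '' S) = MeasureTheory.volume S := by
  obtain ⟨g, hg⟩ := hF.isAffineOnCell k
  obtain ⟨-, -, -, -, -, hE, hP⟩ := hF
  obtain ⟨ht, hts, hs, hsq⟩ := h
  rw [image_congr fun x hx => hg (hS hx)]
  have hv {v : Pt} (hv : v ∈ cellVertices s t k) : g v = F v :=
    (hg (subset_convexHull ℝ _ hv)).symm
  rcases k with i | i | _
  · refine volume_image_affineMap (a := Ept i) (b := Ept (i + 1)) (c := Ppt s t i) ?_ ?_ S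
    · fin_cases i <;> simp [cross, Ept, Ppt] <;> nlinarith
    · rw [hv (by simp [cellVertices]), hv (by simp [cellVertices]), hv (by simp [cellVertices]),
        hE, hE, hP]
      left
      fin_cases i <;> simp [cross, Ept, Ppt, Ppt']
  · refine volume_image_affineMap (a := Ept i) (b := Ppt s t i) (c := Ppt s t (i - 1)) ?_ ?_ S
    · refine ne_of_gt ?_
      fin_cases i <;> simp [cross, Ept, Ppt] <;> nlinarith
    · rw [hv (by simp [cellVertices]), hv (by simp [cellVertices]), hv (by simp [cellVertices]),
        hE, hP, hP]
      left
      fin_cases i <;> simp [cross, Ept, Ppt, Ppt'] <;> nlinarith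
  · refine volume_image_affineMap (a := Ppt s t 0) (b := Ppt s t 1) (c := Ppt s t 2) ?_ ?_ S
    · refine ne_of_gt ?_
      simp [cross, Ppt]
      nlinarith
    · rw [hv (by simp [cellVertices]), hv (by simp [cellVertices]), hv (by simp [cellVertices]),
        hP, hP, hP]
      left
      simp [cross, Ppt, Ppt']
      nlinarith

lemma IsPAMap.volume_image_le (h : IsAdmissible s t) (hF : IsPAMap s t F) {S : Set Pt}
    (hS : S ⊆ unitSq) : MeasureTheory.volume (F '' S) ≤ MeasureTheory.volume S := by
  refine volume_image_le_of_cover (K := fun k => convexHull ℝ (cellVertices s t k)) Finset.univ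
    (fun k => ((finite_cellVertices s t k).isCompact_convexHull ℝ).isClosed.measurableSet)
    (fun k S hS => (hF.volume_image_cell h k hS).le) S fun x hx => ?_
  simpa using exists_mem_cell h (hS hx)

lemma volume_image_reflection (S : Set Pt) :
    MeasureTheory.volume (reflection '' S) = MeasureTheory.volume S := by
  refine volume_image_affineMap (a := 0) (b := (1, 0)) (c := (0, 1)) ?_ ?_ S <;> simp [cross]

lemma IsPAMap.volume_preimage (h : IsAdmissible s t) (hF : IsPAMap s t F) {S : Set Pt}
    (hS : S ⊆ unitSq) :
    MeasureTheory.volume (unitSq ∩ F ⁻¹' S) = MeasureTheory.volume S := by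
  refine le_antisymm ?_ ?_
  · have hsub : unitSq ∩ F ⁻¹' S ⊆ reflection '' (F '' (reflection '' S)) := by
      rintro x ⟨hx, hxS⟩
      exact ⟨_, ⟨_, ⟨_, hxS, rfl⟩, rfl⟩, hF.involutive h hx⟩
    calc MeasureTheory.volume (unitSq ∩ F ⁻¹' S)
        ≤ MeasureTheory.volume (F '' (reflection '' S)) :=
          (MeasureTheory.measure_mono hsub).trans_eq (volume_image_reflection _)
      _ ≤ MeasureTheory.volume (reflection '' S) :=
          hF.volume_image_le h (image_subset_iff.2 fun x hx => reflection_mem_unitSq (hS hx))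
      _ = MeasureTheory.volume S := volume_image_reflection S
  · have hsub : S ⊆ F '' (unitSq ∩ F ⁻¹' S) := fun x hx =>
      ⟨reflection (F (reflection x)),
        ⟨reflection_mem_unitSq (hF.1 (reflection_mem_unitSq (hS hx))),
          by rwa [mem_preimage, hF.apply_conj h (hS hx)]⟩, hF.apply_conj h (hS hx)⟩
    exact (MeasureTheory.measure_mono hsub).trans (hF.volume_image_le h inter_subset_left)

lemma IsPAMap.apply_of_mem_segment (hF : IsPAMap s t F) (i : Fin 4) {x : Pt}
    (hx : x ∈ segment ℝ (Ept i) (Ept (i + 1))) : F x = x := by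
  obtain ⟨g, hg⟩ := hF.isAffineOnCell (.inl i)
  have hE := hF.2.2.2.2.2.1
  have hv {v : Pt} (hv : v ∈ cellVertices s t (.inl i)) : g v = F v :=
    (hg (subset_convexHull ℝ _ hv)).symm
  rw [← convexHull_pair] at hx
  rw [hg (convexHull_mono (by simp [cellVertices, insert_subset_iff]) hx)]
  refine affineMap_eqOn_convexHull (g := AffineMap.id ℝ Pt) ?_ hx
  rintro v (rfl | rfl)
  · exact (hv (by simp [cellVertices])).trans (hE _)
  · exact (hv (by simp [cellVertices])).trans (hE _)

end

lemma exists_mem_segment_of_mem_frontier {x : Pt} (hx : x ∈ frontier unitSq) :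
    ∃ i, x ∈ segment ℝ (Ept i) (Ept (i + 1)) := by
  obtain ⟨x, y⟩ := x
  rw [unitSq, frontier_prod_eq, frontier_Icc zero_le_one, closure_Icc] at hx
  rcases hx with ⟨⟨h0, h1⟩, rfl | rfl⟩ | ⟨rfl | rfl, h0, h1⟩
  · exact ⟨0, 1 - x, x, by linarith, h0, by ring, by simp [Ept]⟩
  · exact ⟨2, x, 1 - x, h0, by linarith, by ring, by simp [Ept]⟩
  · exact ⟨3, y, 1 - y, h0, by linarith, by ring, by simp [Ept]⟩
  · exact ⟨1, 1 - y, y, by linarith, h0, by ring, by simp [Ept]⟩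

/-- There is exactly one continuous map `F : Q → Q` that is affine on
each of the nine pieces and satisfies `F Eᵢ = Eᵢ`, `F Pᵢ = Pᵢ′`; moreover it is a
homeomorphism of the square, preserves two-dimensional Lebesgue measure, and fixes
the boundary of the square pointwise. -/
theorem square_map_exists_unique (θ : ℝ) (hθ : θ ∈ Ioo 0 (π/4))
    (t s : ℝ) (ht : t = sin θ ^ 2) (hs : s = sin θ * cos θ) :
    ∃ F : Pt → Pt, IsPAMap s t F ∧
      (∀ G : Pt → Pt, IsPAMap s t G → EqOn G F unitSq) ∧
      (∃ h : unitSq ≃ₜ unitSq, ∀ x : unitSq, (h x : Pt) = F x) ∧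
      (∀ S : Set Pt, MeasurableSet S → S ⊆ unitSq →
        MeasureTheory.volume (unitSq ∩ F ⁻¹' S) = MeasureTheory.volume S) ∧
      (∀ x ∈ frontier unitSq, F x = x) := by
  have h : IsAdmissible s t := by
    rw [ht, hs]
    exact isAdmissible_sin_cos hθ
  have hF := isPAMap_squareMap h
  refine ⟨squareMap s t, hF, fun G hG => hG.eqOn h hF, hF.exists_homeomorph h,
    fun S _ hS => hF.volume_preimage h hS, fun x hx => ?_⟩
  obtain ⟨i, hi⟩ := exists_mem_segment_of_mem_frontier hx
  exact hF.apply_of_mem_segment i hi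
end
end

section
/- Let S : ℝ² → ℝ² be the reflection S(x,y) = (y,x). Then S conjugates F to its inverse, i.e. S ∘ F ∘ S = F⁻¹; equivalently, S(F(S(F(p)))) = p and F(S(F(S(p)))) = p for every p ∈ Q. -/
open Real Set Filter

noncomputable section

/-- The reflection `S(x,y) = (y,x)`. -/
def Smap : Pt → Pt := fun p => (p.2, p.1)

/-- An affine-on-cells map that sends the vertices `X` of one cell into the vertices `Y` of another
and is involutive on `X` is involutive on the whole cell. -/
lemma involutive_on_convexHull {G : Pt → Pt} {X Y : Set Pt} {g g' : Pt →ᵃ[ℝ] Pt}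
    (hg : EqOn G g (convexHull ℝ X)) (hg' : EqOn G g' (convexHull ℝ Y))
    (hXY : MapsTo G X Y) (hinv : ∀ x ∈ X, G (G x) = x) :
    ∀ p ∈ convexHull ℝ X, G (G p) = p := by
  have hmaps : MapsTo g (convexHull ℝ X) (convexHull ℝ Y) := by
    rw [mapsTo_iff_image_subset, AffineMap.image_convexHull]
    refine convexHull_mono ?_
    rintro _ ⟨x, hx, rfl⟩
    rw [← hg (subset_convexHull ℝ X hx)]
    exact hXY hx
  have hcomp : EqOn (g'.comp g) (AffineMap.id ℝ Pt) (affineSpan ℝ X) := by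
    refine AffineMap.eqOn_affineSpan fun x hx => ?_
    have hx' := subset_convexHull ℝ X hx
    rw [AffineMap.comp_apply, ← hg' (hmaps hx'), ← hg hx', hinv x hx, AffineMap.id_apply]
  intro p hp
  rw [hg hp, hg' (hmaps hp)]
  exact hcomp (convexHull_subset_affineSpan X hp)

/-- Twice the signed area of the triangle `a b p`. -/
def signedArea (a b p : Pt) : ℝ := (b.1 - a.1) * (p.2 - a.2) - (b.2 - a.2) * (p.1 - a.1)

lemma mem_convexHull_triangle_s2 {a b c p : Pt} (habc : 0 < signedArea a b c)
    (hab : 0 ≤ signedArea a b p) (hbc : 0 ≤ signedArea b c p) (hca : 0 ≤ signedArea c a p) :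
    p ∈ convexHull ℝ {a, b, c} := by
  have hsum : signedArea b c p + signedArea c a p + signedArea a b p = signedArea a b c := by
    simp only [signedArea]; ring
  have hp : (signedArea b c p / signedArea a b c) • a + (signedArea c a p / signedArea a b c) • b
      + (signedArea a b p / signedArea a b c) • c = p := by
    ext <;> simp only [Prod.fst_add, Prod.snd_add, Prod.smul_fst, Prod.smul_snd, smul_eq_mul] <;>
      field_simp <;> simp only [signedArea] <;> ring
  rw [← hp]
  have hmem {x : Pt} (hx : x ∈ ({a, b, c} : Set Pt)) := subset_convexHull ℝ _ hx
  have hconv := (convex_convexHull ℝ ({a, b, c} : Set Pt)).sum_mem (t := Finset.univ)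
    (w := ![signedArea b c p / signedArea a b c, signedArea c a p / signedArea a b c,
      signedArea a b p / signedArea a b c]) (z := ![a, b, c])
  simp only [Fin.sum_univ_three, Matrix.cons_val] at hconv
  refine hconv ?_ ?_ ?_
  · intro i _
    fin_cases i <;> simp <;> positivity
  · rw [← add_div, ← add_div, hsum, div_self habc.ne']
  · intro i _
    fin_cases i <;> exact hmem (by simp)

lemma signedArea_swap (a b p : Pt) : signedArea b a p = -signedArea a b p := by
  simp only [signedArea]; ring

/-- `edgeForm σ c i` vanishes on the line through `Eᵢ`, `Pᵢ`, `Pᵢ₊₁`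
and is nonnegative on the central square, where `σ = sin θ`, `c = cos θ`. -/
def edgeForm (σ c : ℝ) (i : Fin 4) (p : Pt) : ℝ :=
  ![c * p.2 - σ * p.1, c * (1 - p.1) - σ * p.2, c * (1 - p.2) - σ * (1 - p.1),
    c * p.1 - σ * (1 - p.2)] i

section Cover

variable {σ c : ℝ}

lemma signedArea_Ept_Ppt (i : Fin 4) (p : Pt) :
    signedArea (Ept i) (Ppt (σ * c) (σ ^ 2) i) p = σ * edgeForm σ c i p := by
  fin_cases i <;> simp [signedArea, Ept, Ppt, edgeForm] <;> ring

lemma signedArea_Ppt_Ppt (h : σ ^ 2 + c ^ 2 = 1) (i : Fin 4) (p : Pt) :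
    signedArea (Ppt (σ * c) (σ ^ 2) i) (Ppt (σ * c) (σ ^ 2) (i + 1)) p
      = (c - σ) * edgeForm σ c i p := by
  fin_cases i <;> simp [signedArea, Ppt, edgeForm] <;> grind

lemma signedArea_Ept_Ept_Ppt (s t : ℝ) (i : Fin 4) :
    signedArea (Ept i) (Ept (i + 1)) (Ppt s t i) = t := by
  fin_cases i <;> simp [signedArea, Ept, Ppt]

lemma edgeForm_succ_Ppt (h : σ ^ 2 + c ^ 2 = 1) (i : Fin 4) :
    edgeForm σ c (i + 1) (Ppt (σ * c) (σ ^ 2) i) = c - σ := by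
  fin_cases i <;> simp [Ppt, edgeForm] <;> grind

lemma signedArea_Ept_Ept_nonneg {p : Pt} (hp : p ∈ unitSq) (i : Fin 4) :
    0 ≤ signedArea (Ept i) (Ept (i + 1)) p := by
  obtain ⟨⟨h1, h2⟩, h3, h4⟩ := hp
  fin_cases i <;> simp [signedArea, Ept] <;> assumption

lemma mem_Apiece_or_Bpiece (h : σ ^ 2 + c ^ 2 = 1) (hσ : 0 < σ) (hc : σ < c) {p : Pt}
    (hp : p ∈ unitSq) {i : Fin 4} (hi : edgeForm σ c i p ≤ 0)
    (hi' : 0 ≤ edgeForm σ c (i + 1) p) :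
    p ∈ Apiece (σ * c) (σ ^ 2) i ∨ p ∈ Bpiece (σ * c) (σ ^ 2) (i + 1) := by
  have hcσ : 0 < c - σ := sub_pos.mpr hc
  rcases le_total 0 (signedArea (Ept (i + 1)) (Ppt (σ * c) (σ ^ 2) i) p) with hm | hm
  · left
    refine mem_convexHull_triangle_s2 ?_ (signedArea_Ept_Ept_nonneg hp i) hm ?_
    · rw [signedArea_Ept_Ept_Ppt]; positivity
    · rw [signedArea_swap, signedArea_Ept_Ppt]
      nlinarith
  · right
    rw [Bpiece, add_sub_cancel_right]
    refine mem_convexHull_triangle_s2 ?_ ?_ ?_ ?_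
    · rw [signedArea_Ept_Ppt, edgeForm_succ_Ppt h]; positivity
    · rw [signedArea_Ept_Ppt]; positivity
    · rw [signedArea_swap, signedArea_Ppt_Ppt h]
      nlinarith
    · rw [signedArea_swap]; linarith

lemma mem_Cpiece (h : σ ^ 2 + c ^ 2 = 1) (hc : σ < c) {p : Pt}
    (hp : ∀ i, 0 ≤ edgeForm σ c i p) : p ∈ Cpiece (σ * c) (σ ^ 2) := by
  have hcσ : 0 < c - σ := sub_pos.mpr hc
  have hside (i : Fin 4) : 0 ≤ signedArea (Ppt (σ * c) (σ ^ 2) i)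
      (Ppt (σ * c) (σ ^ 2) (i + 1)) p := by
    rw [signedArea_Ppt_Ppt h]; exact mul_nonneg hcσ.le (hp i)
  rcases le_total 0 (signedArea (Ppt (σ * c) (σ ^ 2) 2) (Ppt (σ * c) (σ ^ 2) 0) p) with hm | hm
  · refine convexHull_mono ?_ (mem_convexHull_triangle_s2 ?_ (hside 0) (hside 1) hm)
    · intro x; simp; tauto
    · have : signedArea (Ppt (σ * c) (σ ^ 2) 0) (Ppt (σ * c) (σ ^ 2) (0 + 1))
          (Ppt (σ * c) (σ ^ 2) (1 + 1)) = (c - σ) ^ 2 := by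
        simp [signedArea, Ppt]; grind
      rw [this]; positivity
  · refine convexHull_mono ?_ (mem_convexHull_triangle_s2 ?_ ?_ (hside 2) (hside 3))
    · intro x; simp; tauto
    · have : signedArea (Ppt (σ * c) (σ ^ 2) (3 + 1)) (Ppt (σ * c) (σ ^ 2) 2)
          (Ppt (σ * c) (σ ^ 2) (2 + 1)) = (c - σ) ^ 2 := by
        simp [signedArea, Ppt]; grind
      rw [this]; positivity
    · rw [signedArea_swap]; exact neg_nonneg.mpr hm

/-- The nine pieces cover the unit square. -/
lemma mem_piece_of_mem_unitSq (h : σ ^ 2 + c ^ 2 = 1) (hσ : 0 < σ) (hc : σ < c) {p : Pt}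
    (hp : p ∈ unitSq) :
    (∃ i, p ∈ Apiece (σ * c) (σ ^ 2) i) ∨ (∃ i, p ∈ Bpiece (σ * c) (σ ^ 2) i) ∨
      p ∈ Cpiece (σ * c) (σ ^ 2) := by
  by_cases hsec : ∃ i, edgeForm σ c i p ≤ 0 ∧ 0 ≤ edgeForm σ c (i + 1) p
  · obtain ⟨i, hi, hi'⟩ := hsec
    rcases mem_Apiece_or_Bpiece h hσ hc hp hi hi' with hA | hB
    · exact Or.inl ⟨i, hA⟩
    · exact Or.inr (Or.inl ⟨i + 1, hB⟩)
  · push Not at hsec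
    refine Or.inr (Or.inr (mem_Cpiece h hc ?_))
    by_contra! hneg
    obtain ⟨j, hj⟩ := hneg
    have h1 := hsec j hj.le
    have h2 := hsec _ h1.le
    have hopp : edgeForm σ c j p + edgeForm σ c (j + 1 + 1) p = c - σ := by
      fin_cases j <;> simp [edgeForm] <;> ring
    linarith

end Cover

/-- `S` as an affine map. -/
def SmapAffine : Pt →ᵃ[ℝ] Pt := ((LinearMap.snd ℝ ℝ ℝ).prod (LinearMap.fst ℝ ℝ ℝ)).toAffineMap

lemma exists_affine_Smap_comp {F : Pt → Pt} {X : Set Pt} (h : ∃ g : Pt →ᵃ[ℝ] Pt, EqOn F g X) :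
    ∃ g : Pt →ᵃ[ℝ] Pt, EqOn (fun p => Smap (F p)) g X := by
  obtain ⟨g, hg⟩ := h
  refine ⟨SmapAffine.comp g, fun p hp => ?_⟩
  change Smap (F p) = Smap (g p)
  rw [hg hp]

lemma Smap_Ept (i : Fin 4) : Smap (Ept i) = Ept (-i) := by
  fin_cases i <;> rfl

lemma Smap_Ppt' (s t : ℝ) (i : Fin 4) : Smap (Ppt' s t i) = Ppt s t (-i - 1) := by
  fin_cases i <;> rfl

/-- `S ∘ F` is an involution of the square. -/
lemma Smap_comp_involutive {σ c : ℝ} (h : σ ^ 2 + c ^ 2 = 1) (hσ : 0 < σ) (hc : σ < c)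
    {F : Pt → Pt} (hF : IsPAMap (σ * c) (σ ^ 2) F) {p : Pt} (hp : p ∈ unitSq) :
    Smap (F (Smap (F p))) = p := by
  obtain ⟨-, -, hA, hB, hC, hE, hP⟩ := hF
  have hGE (i : Fin 4) : Smap (F (Ept i)) = Ept (-i) := by rw [hE, Smap_Ept]
  have hGP (i : Fin 4) : Smap (F (Ppt (σ * c) (σ ^ 2) i)) = Ppt (σ * c) (σ ^ 2) (-i - 1) := by
    rw [hP, Smap_Ppt']
  have hPP (i : Fin 4) : -(-i - 1) - 1 = i := by abel
  rcases mem_piece_of_mem_unitSq h hσ hc hp with ⟨i, hi⟩ | ⟨i, hi⟩ | hp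
  · obtain ⟨g, hg⟩ := exists_affine_Smap_comp (hA i)
    obtain ⟨g', hg'⟩ := exists_affine_Smap_comp (hA (-i - 1))
    refine involutive_on_convexHull hg hg' ?_ ?_ p hi
    · rintro x (rfl | rfl | rfl)
      · simp [hGE]
      · simp only [hGE, neg_add, ← sub_eq_add_neg]; simp
      · simp [hGP]
    · rintro x (rfl | rfl | rfl) <;> simp only [hGE, hGP, neg_neg, hPP]
  · obtain ⟨g, hg⟩ := exists_affine_Smap_comp (hB i)
    obtain ⟨g', hg'⟩ := exists_affine_Smap_comp (hB (-i))
    refine involutive_on_convexHull hg hg' ?_ ?_ p hi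
    · rintro x (rfl | rfl | rfl)
      · simp [hGE]
      · simp [hGP]
      · simp [hGP]
    · rintro x (rfl | rfl | rfl) <;> simp only [hGE, hGP, neg_neg, hPP]
  · obtain ⟨g, hg⟩ := exists_affine_Smap_comp hC
    refine involutive_on_convexHull hg hg ?_ ?_ p hp
    · have hmem (j : Fin 4) : Ppt (σ * c) (σ ^ 2) j ∈ ({Ppt (σ * c) (σ ^ 2) 0,
          Ppt (σ * c) (σ ^ 2) 1, Ppt (σ * c) (σ ^ 2) 2, Ppt (σ * c) (σ ^ 2) 3} : Set Pt) := by
        fin_cases j <;> simp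
      rintro x (rfl | rfl | rfl | rfl) <;> simp only [hGP] <;> exact hmem _
    · rintro x (rfl | rfl | rfl | rfl) <;> simp only [hGP, hPP]

/-- `S` conjugates `F` to its inverse: `S ∘ F ∘ S = F⁻¹`, i.e.
`S (F (S (F p))) = p` and `F (S (F (S p))) = p` for every `p ∈ Q`. -/
theorem square_map_S_reversible (θ : ℝ) (hθ : θ ∈ Ioo 0 (π/4))
    (t s : ℝ) (ht : t = sin θ ^ 2) (hs : s = sin θ * cos θ)
    (F : Pt → Pt) (hF : IsPAMap s t F) :
    ∀ p ∈ unitSq, Smap (F (Smap (F p))) = p ∧ F (Smap (F (Smap p))) = p := by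
  have hσ : 0 < sin θ := sin_pos_of_pos_of_lt_pi hθ.1 (by linarith [hθ.2, pi_pos])
  have hc : sin θ < cos θ := by
    rw [← sin_pi_div_two_sub]
    exact sin_lt_sin_of_lt_of_le_pi_div_two (by linarith [hθ.1, pi_pos]) (by linarith [hθ.1])
      (by linarith [hθ.2])
  subst ht hs
  intro p hp
  have hinv {q : Pt} (hq : q ∈ unitSq) : Smap (F (Smap (F q))) = q :=
    Smap_comp_involutive (sin_sq_add_cos_sq θ) hσ hc hF hq
  exact ⟨hinv hp, congrArg Smap (hinv (q := Smap p) ⟨hp.2, hp.1⟩)⟩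
end
end

section
/- On the central piece 𝒞, F is given by F(x,y) = (2s·x + (2t−1)·y + 1−t−s, (1−2t)·x + 2s·y + t−s), and this affine map is exactly the rotation of the plane about Z = (1/2, 1/2) through the angle α = π/2 − 2θ. -/
open Real Set Filter

noncomputable section

/-- Affine maps of the plane commute with convex combinations, so the set on which one of them agrees
with a given formula affine in the coordinates is convex. -/
theorem convex_setOf_affineMap_eq_formula (g : Pt →ᵃ[ℝ] Pt) (a b c a' b' c' : ℝ) :
    Convex ℝ {p : Pt | g p = (a * p.1 + b * p.2 + c, a' * p.1 + b' * p.2 + c')} := by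
  intro x hx y hy u v _ _ huv
  simp only [mem_ofPred_eq] at hx hy ⊢
  rw [Convex.combo_affine_apply huv, hx, hy]
  ext <;> simp only [Prod.fst_add, Prod.snd_add, Prod.smul_fst, Prod.smul_snd, smul_eq_mul]
  · linear_combination c * huv
  · linear_combination c' * huv

/-- On the central piece `𝒞`, `F` is given by
`(x,y) ↦ (2sx + (2t-1)y + 1-t-s, (1-2t)x + 2sy + t-s)`, and this affine map is
exactly the rotation of the plane about `Z = (1/2,1/2)` through the angle
`α = π/2 - 2θ`. -/
theorem square_map_rotation_on_C (θ : ℝ) (hθ : θ ∈ Ioo 0 (π/4))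
    (t s : ℝ) (ht : t = sin θ ^ 2) (hs : s = sin θ * cos θ)
    (F : Pt → Pt) (hF : IsPAMap s t F) :
    (∀ p ∈ Cpiece s t,
      F p = (2*s*p.1 + (2*t-1)*p.2 + 1 - t - s, (1-2*t)*p.1 + 2*s*p.2 + t - s)) ∧
    (∀ p : Pt,
      ((2*s*p.1 + (2*t-1)*p.2 + 1 - t - s, (1-2*t)*p.1 + 2*s*p.2 + t - s) : Pt) =
      (1/2 + cos (π/2 - 2*θ) * (p.1 - 1/2) - sin (π/2 - 2*θ) * (p.2 - 1/2),
       1/2 + sin (π/2 - 2*θ) * (p.1 - 1/2) + cos (π/2 - 2*θ) * (p.2 - 1/2))) := by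
  have hst : s ^ 2 = t - t ^ 2 := by
    rw [hs, ht, mul_pow, Real.cos_sq']
    ring
  obtain ⟨-, -, -, -, ⟨g, hg⟩, -, hP⟩ := hF
  refine ⟨fun p hp => ?_, fun p => ?_⟩
  · have hsub : Cpiece s t ⊆ {p : Pt | g p =
        (2*s * p.1 + (2*t-1) * p.2 + (1 - t - s), (1-2*t) * p.1 + 2*s * p.2 + (t - s))} := by
      refine convexHull_min (fun q hq => ?_) (convex_setOf_affineMap_eq_formula g _ _ _ _ _ _)
      have hgq : F q = g q := hg (subset_convexHull ℝ _ hq)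
      simp only [mem_insert_iff, mem_singleton_iff] at hq
      rw [mem_ofPred_eq, ← hgq]
      rcases hq with rfl | rfl | rfl | rfl <;> rw [hP] <;> ext <;> simp [Ppt, Ppt'] <;>
        first
          | ring1
          | linear_combination 2 * hst
          | linear_combination -2 * hst
    rw [hg hp, hsub hp]
    ext <;> dsimp only <;> ring
  · have hcos : cos (π/2 - 2*θ) = 2 * s := by
      rw [cos_pi_div_two_sub, sin_two_mul, hs]
      ring
    have hsin : sin (π/2 - 2*θ) = 1 - 2 * t := by
      rw [sin_pi_div_two_sub, cos_two_mul, Real.cos_sq', ht]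
      ring
    rw [hcos, hsin]
    ext <;> dsimp only <;> ring
end
end

section
/- For every θ ∈ (0, π/4) and every integer N ≥ 0, the point Y_N = (1/(1 + N(1−2s)))·(s, t) lies on the segment [E₁, P₁] = ℬ₁ ∩ 𝒜₁ and satisfies F^n(Y_N) ∈ 𝒜₁ for all 0 ≤ n < N and F^N(Y_N) ∈ [E₂, P₁] = 𝒜₁ ∩ ℬ₂. Moreover Y_N → E₁ = (0,0) as N → ∞. -/
open Real Set Filter

noncomputable section

/-- Barycentric description of the convex hull of three points. -/
theorem mem_convexHull_triple {E : Type*} [AddCommGroup E] [Module ℝ E] {x y z p : E} :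
    p ∈ convexHull ℝ {x, y, z} ↔
      ∃ a b c : ℝ, 0 ≤ a ∧ 0 ≤ b ∧ 0 ≤ c ∧ a + b + c = 1 ∧ a • x + b • y + c • z = p := by
  constructor
  · rw [convexHull_insert ⟨y, by simp⟩, convexHull_pair, mem_convexJoin]
    rintro ⟨x', rfl, q, ⟨b, c, hb, hc, hbc, rfl⟩, u, v, hu, hv, huv, rfl⟩
    refine ⟨u, v * b, v * c, hu, by positivity, by positivity, ?_, ?_⟩
    · linear_combination huv + v * hbc
    · rw [smul_add, smul_smul, smul_smul, add_assoc]
  · rintro ⟨a, b, c, ha, hb, hc, habc, rfl⟩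
    have hmem : ∀ q ∈ ({x, y, z} : Set E), q ∈ convexHull ℝ {x, y, z} :=
      fun q hq => subset_convexHull ℝ _ hq
    simpa [Fin.sum_univ_three] using (convex_convexHull ℝ {x, y, z}).sum_mem
      (t := Finset.univ) (w := ![a, b, c]) (z := ![x, y, z])
      (by intro i _; fin_cases i <;> assumption) (by simp [Fin.sum_univ_three, habc])
      (by intro i _; fin_cases i <;> exact hmem _ (by simp))

theorem segment_E0P0_eq {s t : ℝ} (ht : 0 < t) (hts : t < s) (hst : s ^ 2 = t - t ^ 2) :
    segment ℝ (Ept 0) (Ppt s t 0) = Bpiece s t 0 ∩ Apiece s t 0 := by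
  apply Subset.antisymm
  · refine subset_inter ?_ ?_ <;>
      exact (convex_convexHull ℝ _).segment_subset
        (subset_convexHull ℝ _ (by simp)) (subset_convexHull ℝ _ (by simp))
  · rintro ⟨x, y⟩ ⟨hB, hA⟩
    obtain ⟨a, b, c, ha, hb, hc, habc, hp⟩ := mem_convexHull_triple.1 hB
    obtain ⟨a', b', c', -, hb', -, -, hq⟩ := mem_convexHull_triple.1 hA
    have h3 : (0 - 1 : Fin 4) = 3 := rfl
    simp only [h3, Ept, Ppt, Matrix.cons_val, Prod.smul_mk, Prod.mk_add_mk, Prod.mk.injEq,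
      smul_eq_mul, zero_add, Fin.isValue] at hp hq
    obtain ⟨hp1, hp2⟩ := hp
    obtain ⟨hq1, hq2⟩ := hq
    have key : c * (s - t) + b' * t = 0 := by
      linear_combination t * hq1 - s * hq2 - t * hp1 + s * hp2 + c * hst
    have hc0 : c = 0 := by
      by_contra h
      have : 0 < c * (s - t) := mul_pos (lt_of_le_of_ne hc (Ne.symm h)) (by linarith)
      nlinarith [mul_nonneg hb' ht.le]
    subst hc0
    refine ⟨a, b, ha, hb, by linarith, ?_⟩
    simp only [Ept, Ppt, Matrix.cons_val, Prod.smul_mk, Prod.mk_add_mk, Prod.mk.injEq,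
      smul_eq_mul]
    constructor <;> linarith

theorem segment_E1P0_eq {s t : ℝ} (ht : 0 < t) (hts : t < s) (hst : s ^ 2 = t - t ^ 2) :
    segment ℝ (Ept 1) (Ppt s t 0) = Apiece s t 0 ∩ Bpiece s t 1 := by
  apply Subset.antisymm
  · refine subset_inter ?_ ?_ <;>
      exact (convex_convexHull ℝ _).segment_subset
        (subset_convexHull ℝ _ (by simp)) (subset_convexHull ℝ _ (by simp))
  · rintro ⟨x, y⟩ ⟨hA, hB⟩
    obtain ⟨a, b, c, ha, hb, hc, habc, hp⟩ := mem_convexHull_triple.1 hA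
    obtain ⟨a', b', c', -, hb', -, habc', hq⟩ := mem_convexHull_triple.1 hB
    have h1 : (1 - 1 : Fin 4) = 0 := rfl
    simp only [h1, Ept, Ppt, Matrix.cons_val, Prod.smul_mk, Prod.mk_add_mk, Prod.mk.injEq,
      smul_eq_mul, zero_add, Fin.isValue] at hp hq
    obtain ⟨hp1, hp2⟩ := hp
    obtain ⟨hq1, hq2⟩ := hq
    have key : b' * (s - t) + a * t = 0 := by
      linear_combination t * hq1 + (1 - s) * hq2 - t * hp1 - (1 - s) * hp2 + b' * hst
        + t * habc - t * habc'
    have ha0 : a = 0 := by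
      by_contra h
      have : 0 < a * t := mul_pos (lt_of_le_of_ne ha (Ne.symm h)) ht
      nlinarith [mul_nonneg hb' (sub_pos.2 hts).le]
    subst ha0
    refine ⟨b, c, hb, hc, by linarith, ?_⟩
    simp only [Ept, Ppt, Matrix.cons_val, Prod.smul_mk, Prod.mk_add_mk, Prod.mk.injEq,
      smul_eq_mul]
    constructor <;> linarith

/-- On `𝒜₁` the map shears horizontally: it adds `c * (1 - 2s)` to the abscissa, where `c` is the
barycentric weight of `P₁`. -/
theorem IsPAMap.apply_of_weights {s t : ℝ} {F : Pt → Pt} (hF : IsPAMap s t F) {b c : ℝ}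
    (hb : 0 ≤ b) (hc : 0 ≤ c) (hbc : b + c ≤ 1) :
    F (b + c * s, c * t) = (b + c * s + c * (1 - 2 * s), c * t) := by
  obtain ⟨-, -, hA, -, -, hE, hP⟩ := hF
  obtain ⟨g, hg⟩ := hA 0
  have hmem : ((b + c * s, c * t) : Pt) ∈ Apiece s t 0 :=
    mem_convexHull_triple.2 ⟨1 - b - c, b, c, by linarith, hb, hc, by ring, by
      simp [Ept, Ppt]⟩
  have g0 : g (0, 0) = (0, 0) := by
    have h := hg (subset_convexHull ℝ _ (by simp) : Ept 0 ∈ Apiece s t 0)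
    rw [hE 0] at h
    exact h.symm
  have g1 : g (1, 0) = (1, 0) := by
    have h := hg (subset_convexHull ℝ _ (by simp) : Ept 1 ∈ Apiece s t 0)
    rw [hE 1] at h
    exact h.symm
  have gP : g (s, t) = (1 - s, t) := by
    have h := hg (subset_convexHull ℝ _ (by simp) : Ppt s t 0 ∈ Apiece s t 0)
    rw [hP 0] at h
    exact h.symm
  have hlin : ∀ p, g p = g.linear p := fun p => by
    have h := g.map_vadd 0 p
    rw [show g 0 = 0 from g0] at h
    simpa using h
  have hdec : ((b + c * s, c * t) : Pt) = b • ((1, 0) : Pt) + c • ((s, t) : Pt) := by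
    simp
  rw [hg hmem, hdec, hlin, map_add, map_smul, map_smul, ← hlin, ← hlin, g1, gP]
  simp only [Prod.smul_mk, Prod.mk_add_mk, Prod.mk.injEq, smul_eq_mul]
  constructor <;> ring

theorem IsPAMap.iterate_apply {s t : ℝ} {F : Pt → Pt} (hF : IsPAMap s t F) (hs : s < 1 / 2)
    {c : ℝ} (hc : 0 ≤ c) {n : ℕ} (hn : c * (1 + n * (1 - 2 * s)) ≤ 1) :
    F^[n] (c • ((s, t) : Pt)) = (c * n * (1 - 2 * s) + c * s, c * t) := by
  induction n with
  | zero => simp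
  | succ n ih =>
    have hd : 0 ≤ c * (1 - 2 * s) := mul_nonneg hc (by linarith)
    push_cast at hn
    have hn' : c * (1 + n * (1 - 2 * s)) ≤ 1 := by linarith
    have hb : 0 ≤ c * n * (1 - 2 * s) := by
      rw [mul_right_comm]; positivity
    rw [Function.iterate_succ_apply', ih hn', hF.apply_of_weights hb hc (by linarith)]
    push_cast
    simp only [Prod.mk.injEq, and_true]
    ring

theorem tendsto_inv_smul_nhds_zero {d : ℝ} (hd : 0 < d) (p : Pt) :
    Tendsto (fun M : ℕ => (1 / (1 + M * d)) • p) atTop (nhds 0) := by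
  have h : Tendsto (fun M : ℕ => 1 + (M : ℝ) * d) atTop atTop :=
    tendsto_atTop_add_const_left _ _ (tendsto_natCast_atTop_atTop.atTop_mul_const hd)
  simpa only [one_div, zero_smul, Function.comp_def] using
    (tendsto_inv_atTop_zero.comp h).smul_const p

theorem sin_sq_sin_mul_cos_bounds {θ : ℝ} (hθ : θ ∈ Ioo 0 (π / 4)) :
    0 < sin θ ^ 2 ∧ sin θ ^ 2 < sin θ * cos θ ∧ sin θ * cos θ < 1 / 2 := by
  obtain ⟨h0, h1⟩ := hθ
  have hsin : 0 < sin θ := sin_pos_of_pos_of_lt_pi h0 (by linarith [pi_pos])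
  have hlt : sin θ < cos θ := by
    rw [← sin_pi_div_two_sub]
    exact sin_lt_sin_of_lt_of_le_pi_div_two (by linarith [pi_pos]) (by linarith) (by linarith)
  refine ⟨by positivity, by nlinarith, ?_⟩
  nlinarith [sin_sq_add_cos_sq θ, mul_pos (sub_pos.2 hlt) (sub_pos.2 hlt)]

/-- For every `θ ∈ (0, π/4)` and every `N ≥ 0`, the point
`Y_N = (1/(1 + N(1-2s))) • (s,t)` lies on the segment `[E₁,P₁] = ℬ₁ ∩ 𝒜₁`,
satisfies `Fⁿ(Y_N) ∈ 𝒜₁` for `0 ≤ n < N` and `F^N(Y_N) ∈ [E₂,P₁] = 𝒜₁ ∩ ℬ₂`;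
moreover `Y_N → E₁` as `N → ∞`. -/
theorem exists_point_on_E1P1 (θ : ℝ) (hθ : θ ∈ Ioo 0 (π/4))
    (t s : ℝ) (ht : t = sin θ ^ 2) (hs : s = sin θ * cos θ)
    (F : Pt → Pt) (hF : IsPAMap s t F) (N : ℕ) :
    (1/(1 + N*(1 - 2*s))) • ((s, t) : Pt) ∈ segment ℝ (Ept 0) (Ppt s t 0) ∧
    segment ℝ (Ept 0) (Ppt s t 0) = Bpiece s t 0 ∩ Apiece s t 0 ∧
    (∀ n < N, F^[n] ((1/(1 + N*(1 - 2*s))) • ((s, t) : Pt)) ∈ Apiece s t 0) ∧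
    F^[N] ((1/(1 + N*(1 - 2*s))) • ((s, t) : Pt)) ∈ segment ℝ (Ept 1) (Ppt s t 0) ∧
    segment ℝ (Ept 1) (Ppt s t 0) = Apiece s t 0 ∩ Bpiece s t 1 ∧
    Tendsto (fun M : ℕ => (1/(1 + M*(1 - 2*s))) • ((s, t) : Pt)) atTop (nhds (Ept 0)) := by
  have hst : s ^ 2 = t - t ^ 2 := by
    rw [hs, ht, mul_pow, cos_sq']; ring
  obtain ⟨ht0, hts, hs2⟩ : 0 < t ∧ t < s ∧ s < 1 / 2 := by
    rw [ht, hs]; exact sin_sq_sin_mul_cos_bounds hθ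
  have hd : 0 < 1 - 2 * s := by linarith
  have hD : 0 < 1 + N * (1 - 2 * s) := by positivity
  obtain ⟨c, hcdef⟩ : ∃ c, c = 1 / (1 + N * (1 - 2 * s)) := ⟨_, rfl⟩
  have hc : 0 ≤ c := by rw [hcdef]; positivity
  have hcD : c * (1 + N * (1 - 2 * s)) = 1 := by rw [hcdef]; field_simp
  have hcd : 0 ≤ c * (1 - 2 * s) := mul_nonneg hc hd.le
  have hcN : 0 ≤ c * N * (1 - 2 * s) := by
    rw [mul_right_comm]; positivity
  rw [← hcdef]
  refine ⟨⟨1 - c, c, by linarith, hc, by ring, by simp [Ept, Ppt]⟩,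
    segment_E0P0_eq ht0 hts hst, fun n hn => ?_, ?_, segment_E1P0_eq ht0 hts hst,
    tendsto_inv_smul_nhds_zero hd _⟩
  · have hnN : (n : ℝ) ≤ N := by exact_mod_cast hn.le
    have hle : c * (1 + n * (1 - 2 * s)) ≤ 1 := by
      nlinarith [mul_le_mul_of_nonneg_right hnN hcd]
    rw [hF.iterate_apply hs2 hc hle]
    exact mem_convexHull_triple.2 ⟨1 - c * n * (1 - 2 * s) - c, c * n * (1 - 2 * s), c,
      by linarith, by rw [mul_right_comm]; positivity, hc, by ring, by simp [Ept, Ppt]⟩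
  · rw [hF.iterate_apply hs2 hc hcD.le]
    exact ⟨c * N * (1 - 2 * s), c, hcN, hc, by linarith, by simp [Ept, Ppt]⟩
end
end
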